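/- arXiv:1605.01981 — 2 statements merged into one kernel-verified Lean document; each statement's English description precedes it below -/
import Mathlib

section
/- Let α, β, γ > 0 be real, t > 0, and s ≥ 0 a real number. Then ∑_{n=1}^∞ n^s (γ)_n t^{αn} / (n! Γ(αn+β)) = γ t^α ∑_{n=0}^∞ (γ+1)_n t^{αn} (n+1)^{s-1} / (n! Γ(αn+α+β)); that is, the s-th fractional raw moment of the Prabhakar-type distribution equals γ t^α Φ^{(1,α)}_{γ+1; α+β}(t^α, 1-s, 1) / Γ(α+β) divided by E_{α,β}^γ(t^α) after normalization. -/
open scoped BigOperators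

/-- Pochhammer symbol `(γ)_k = Γ(γ+k)/Γ(γ)`. -/
noncomputable def poch (γ : ℝ) (k : ℕ) : ℝ := Real.Gamma (γ + k) / Real.Gamma γ

/-- The Prabhakar (three-parameter Mittag-Leffler) function
`E_{α,β}^γ(x) = ∑_{k≥0} (γ)_k x^k / (k! Γ(αk+β))`. -/
noncomputable def prabhakar (α β γ x : ℝ) : ℝ :=
  ∑' k : ℕ, poch γ k * x ^ k / (k.factorial * Real.Gamma (α * k + β))

/-- The shift relation `(γ)_{n+1} = γ (γ+1)_n`. -/
theorem poch_succ (γ : ℝ) (hγ : 0 < γ) (n : ℕ) : poch γ (n + 1) = γ * poch (γ + 1) n := by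
  have hΓ : Real.Gamma γ ≠ 0 := (Real.Gamma_pos_of_pos hγ).ne'
  have hshift : γ + ((n + 1 : ℕ) : ℝ) = γ + 1 + n := by push_cast; ring
  rw [poch, poch, hshift, Real.Gamma_add_one hγ.ne']
  field_simp

/-- Fractional raw moment of order `s ≥ 0`:
`∑_{n≥1} n^s (γ)_n t^{αn}/(n! Γ(αn+β))
   = γ t^α ∑_{n≥0} (γ+1)_n t^{αn} (n+1)^{s-1}/(n! Γ(αn+α+β))`,
the right-hand series being `γ t^α Φ^{(1,α)}_{γ+1;α+β}(t^α, 1-s, 1)/Γ(α+β)`. -/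
theorem prabhakar_fractional_moment (α β γ t s : ℝ) (hα : 0 < α) (hβ : 0 < β) (hγ : 0 < γ)
    (ht : 0 < t) (hs : 0 ≤ s) :
    ∑' n : ℕ, ((n : ℝ) + 1) ^ s * poch γ (n + 1) * t ^ (α * (n + 1))
        / ((n + 1).factorial * Real.Gamma (α * (n + 1) + β))
      = γ * t ^ α * ∑' n : ℕ, poch (γ + 1) n * t ^ (α * n) * ((n : ℝ) + 1) ^ (s - 1)
          / (n.factorial * Real.Gamma (α * n + α + β)) := by
  rw [← tsum_mul_left]
  refine tsum_congr fun n => ?_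
  have hn : (0 : ℝ) < (n : ℝ) + 1 := by positivity
  have hΓ : Real.Gamma (α * n + α + β) ≠ 0 := (Real.Gamma_pos_of_pos (by positivity)).ne'
  have hfac : (n.factorial : ℝ) ≠ 0 := by positivity
  have harg : α * ((n : ℝ) + 1) + β = α * n + α + β := by ring
  rw [poch_succ γ hγ, harg, mul_add, mul_one, Real.rpow_add ht, Real.rpow_sub_one hn.ne',
    Nat.factorial_succ]
  push_cast
  field_simp
end

section
/- Let α, β, γ > 0 be real and t > 0. Define the Turánian difference Δ_T(t) = [E_{α,α+β}^{γ+1}(t^α)]² − E_{α,β}^γ(t^α) · E_{α,2α+β}^{γ+2}(t^α). Then E_{α,β}^γ(t^α) · [ E_{α,α+β}^{γ+1}(t^α) + t^α E_{α,2α+β}^{γ+2}(t^α) ] ≥ γ t^α Δ_T(t). -/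
open scoped BigOperators

theorem poch_pos {γ : ℝ} (hγ : 0 < γ) (k : ℕ) : 0 < poch γ k :=
  div_pos (Real.Gamma_pos_of_pos (by positivity)) (Real.Gamma_pos_of_pos hγ)

theorem poch_succ_right {γ : ℝ} (hγ : 0 < γ) (k : ℕ) :
    poch γ (k + 1) = (γ + k) * poch γ k := by
  have h : γ + ((k + 1 : ℕ) : ℝ) = (γ + k) + 1 := by push_cast; ring
  rw [poch, poch, h, Real.Gamma_add_one (by positivity), mul_div_assoc]

theorem poch_succ_left {γ : ℝ} (hγ : 0 < γ) (k : ℕ) :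
    poch γ (k + 1) = γ * poch (γ + 1) k := by
  have h : γ + ((k + 1 : ℕ) : ℝ) = γ + 1 + k := by push_cast; ring
  have := (Real.Gamma_pos_of_pos hγ).ne'
  rw [poch, poch, h, Real.Gamma_add_one hγ.ne']
  field_simp

/-- The general term of the Prabhakar series. -/
noncomputable def prabhakarTerm (α β γ x : ℝ) (k : ℕ) : ℝ :=
  poch γ k * x ^ k / (k.factorial * Real.Gamma (α * k + β))

theorem prabhakarTerm_pos {α β γ x : ℝ} (hα : 0 < α) (hβ : 0 < β) (hγ : 0 < γ) (hx : 0 < x)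
    (k : ℕ) : 0 < prabhakarTerm α β γ x k := by
  have := poch_pos hγ k
  have := Real.Gamma_pos_of_pos (show 0 < α * k + β by positivity)
  unfold prabhakarTerm
  positivity

/-- Log-convexity of `Γ` bounds the growth of `Γ(y+α)/Γ(y)` from below. -/
theorem rpow_mul_Gamma_le_Gamma_add {α y : ℝ} (hα : 0 < α) (hy : 1 < y) :
    (y - 1) ^ α * Real.Gamma y ≤ Real.Gamma (y + α) := by
  have hy1 : 0 < y - 1 := by linarith
  have hslope := Real.convexOn_log_Gamma.slope_mono_adjacent (x := y - 1) (y := y) (z := y + α)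
    (Set.mem_Ioi.2 hy1) (Set.mem_Ioi.2 (by linarith)) (by linarith) (by linarith)
  have hG1 := Real.Gamma_pos_of_pos hy1
  have hG := Real.Gamma_pos_of_pos (show 0 < y by linarith)
  have hGa := Real.Gamma_pos_of_pos (show 0 < y + α by linarith)
  have hrec : Real.log (Real.Gamma y) = Real.log (y - 1) + Real.log (Real.Gamma (y - 1)) := by
    rw [← Real.log_mul hy1.ne' hG1.ne', ← Real.Gamma_add_one hy1.ne', sub_add_cancel]
  simp only [Function.comp_apply, sub_sub_cancel, div_one, add_sub_cancel_left] at hslope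
  rw [le_div_iff₀ hα] at hslope
  rw [← Real.log_le_log_iff (by positivity) hGa, Real.log_mul (by positivity) hG.ne',
    Real.log_rpow hy1]
  nlinarith

theorem tendsto_Gamma_div_Gamma_add {α : ℝ} (hα : 0 < α) :
    Filter.Tendsto (fun y : ℝ => Real.Gamma y / Real.Gamma (y + α)) Filter.atTop (nhds 0) := by
  have hlim : Filter.Tendsto (fun y : ℝ => ((y - 1) ^ α)⁻¹) Filter.atTop (nhds 0) :=
    ((tendsto_rpow_atTop hα).comp
      (Filter.tendsto_atTop_add_const_right _ (-1 : ℝ) Filter.tendsto_id)).inv_tendsto_atTop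
  refine squeeze_zero' ?_ ?_ hlim
  · filter_upwards [Filter.eventually_gt_atTop (1 : ℝ)] with y hy
    exact div_nonneg (Real.Gamma_pos_of_pos (by linarith)).le
      (Real.Gamma_pos_of_pos (by linarith)).le
  · filter_upwards [Filter.eventually_gt_atTop (1 : ℝ)] with y hy
    have hp : 0 < (y - 1) ^ α := Real.rpow_pos_of_pos (by linarith) _
    rw [div_le_iff₀ (Real.Gamma_pos_of_pos (by linarith)), inv_mul_eq_div, le_div_iff₀ hp,
      mul_comm]
    exact rpow_mul_Gamma_le_Gamma_add hα hy

theorem prabhakarTerm_succ_div {α β γ x : ℝ} (hα : 0 < α) (hβ : 0 < β) (hγ : 0 < γ)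
    (hx : 0 < x) (k : ℕ) :
    prabhakarTerm α β γ x (k + 1) / prabhakarTerm α β γ x k
      = (1 + (γ - 1) / (k + 1)) * x
        * (Real.Gamma (α * k + β) / Real.Gamma (α * k + β + α)) := by
  have := (poch_pos hγ k).ne'
  have := (Real.Gamma_pos_of_pos (show 0 < α * k + β by positivity)).ne'
  have := (Real.Gamma_pos_of_pos (show 0 < α * k + β + α by positivity)).ne'
  have h : α * ((k + 1 : ℕ) : ℝ) + β = α * k + β + α := by push_cast; ring
  have hk : (k : ℝ) + 1 ≠ 0 := by positivity
  rw [prabhakarTerm, prabhakarTerm, poch_succ_right hγ, h, Nat.factorial_succ, pow_succ]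
  push_cast
  field_simp
  ring

theorem summable_prabhakarTerm {α β γ x : ℝ} (hα : 0 < α) (hβ : 0 < β) (hγ : 0 < γ)
    (hx : 0 < x) : Summable (prabhakarTerm α β γ x) := by
  have hpos := prabhakarTerm_pos hα hβ hγ hx
  refine summable_of_ratio_test_tendsto_lt_one zero_lt_one
    (Filter.Eventually.of_forall fun k => (hpos k).ne') ?_
  have hG : Filter.Tendsto
      (fun k : ℕ => Real.Gamma (α * k + β) / Real.Gamma (α * k + β + α)) Filter.atTop (nhds 0) :=
    (tendsto_Gamma_div_Gamma_add hα).comp (Filter.tendsto_atTop_add_const_right _ β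
      (tendsto_natCast_atTop_atTop.const_mul_atTop hα))
  have hk : Filter.Tendsto (fun k : ℕ => (γ - 1) / ((k : ℝ) + 1)) Filter.atTop (nhds 0) :=
    tendsto_const_nhds.div_atTop
      (Filter.tendsto_atTop_add_const_right _ 1 tendsto_natCast_atTop_atTop)
  have := ((hk.const_add 1).mul_const x).mul hG
  rw [mul_zero] at this
  refine this.congr fun k => ?_
  rw [Real.norm_of_nonneg (hpos _).le, Real.norm_of_nonneg (hpos _).le,
    prabhakarTerm_succ_div hα hβ hγ hx]

theorem hasSum_prabhakarTerm {α β γ x : ℝ} (hα : 0 < α) (hβ : 0 < β) (hγ : 0 < γ)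
    (hx : 0 < x) : HasSum (prabhakarTerm α β γ x) (prabhakar α β γ x) :=
  (summable_prabhakarTerm hα hβ hγ hx).hasSum

theorem succ_mul_prabhakarTerm_succ {γ : ℝ} (hγ : 0 < γ) (α β x : ℝ) (k : ℕ) :
    ((k : ℝ) + 1) * prabhakarTerm α β γ x (k + 1)
      = γ * x * prabhakarTerm α (α + β) (γ + 1) x k := by
  have h : α * ((k + 1 : ℕ) : ℝ) + β = α * k + (α + β) := by push_cast; ring
  have hk : (k : ℝ) + 1 ≠ 0 := by positivity
  rw [prabhakarTerm, prabhakarTerm, poch_succ_left hγ, h, Nat.factorial_succ, pow_succ]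
  push_cast
  rw [mul_assoc ((k : ℝ) + 1), ← mul_div_assoc, mul_div_mul_left _ _ hk]
  ring

theorem hasSum_natCast_mul_prabhakarTerm {α β γ x : ℝ} (hα : 0 < α) (hβ : 0 < β) (hγ : 0 < γ)
    (hx : 0 < x) :
    HasSum (fun k : ℕ => (k : ℝ) * prabhakarTerm α β γ x k)
      (γ * x * prabhakar α (α + β) (γ + 1) x) := by
  rw [← hasSum_nat_add_iff' 1]
  simp only [Finset.sum_range_one, Nat.cast_zero, zero_mul, sub_zero, Nat.cast_add, Nat.cast_one,
    succ_mul_prabhakarTerm_succ hγ]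
  exact (hasSum_prabhakarTerm hα (by positivity) (by positivity) hx).mul_left _

theorem hasSum_natCast_sq_mul_prabhakarTerm {α β γ x : ℝ} (hα : 0 < α) (hβ : 0 < β)
    (hγ : 0 < γ) (hx : 0 < x) :
    HasSum (fun k : ℕ => (k : ℝ) ^ 2 * prabhakarTerm α β γ x k)
      (γ * x * (prabhakar α (α + β) (γ + 1) x
        + (γ + 1) * x * prabhakar α (2 * α + β) (γ + 2) x)) := by
  have hαβ : 0 < α + β := by positivity
  have hγ1 : 0 < γ + 1 := by positivity
  have h1 := hasSum_prabhakarTerm hα hαβ hγ1 hx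
  have h2 := hasSum_natCast_mul_prabhakarTerm hα hαβ hγ1 hx
  rw [show α + (α + β) = 2 * α + β by ring, show γ + 1 + 1 = γ + 2 by ring] at h2
  rw [← hasSum_nat_add_iff' 1]
  simp only [Finset.sum_range_one, Nat.cast_zero, ne_eq, OfNat.ofNat_ne_zero, not_false_eq_true,
    zero_pow, zero_mul, sub_zero, Nat.cast_add, Nat.cast_one]
  refine ((h1.add h2).mul_left (γ * x)).congr_fun ?_
  intro k
  linear_combination ((k : ℝ) + 1) * succ_mul_prabhakarTerm_succ hγ α β x k

/-- Cauchy–Schwarz for the moments of a nonnegative weight. -/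
theorem sq_le_mul_of_hasSum_moments {ι : Type*} {a f : ι → ℝ} {S₀ S₁ S₂ : ℝ}
    (ha : ∀ i, 0 ≤ a i) (hS₀ : 0 < S₀) (h₀ : HasSum a S₀)
    (h₁ : HasSum (fun i => f i * a i) S₁) (h₂ : HasSum (fun i => f i ^ 2 * a i) S₂) :
    S₁ ^ 2 ≤ S₀ * S₂ := by
  have h := ((h₂.mul_left (S₀ ^ 2)).sub (h₁.mul_left (2 * S₀ * S₁))).add (h₀.mul_left (S₁ ^ 2))
  have hnonneg := h.nonneg fun i => by
    have := mul_nonneg (sq_nonneg (S₀ * f i - S₁)) (ha i)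
    linarith
  have : 0 ≤ S₀ * (S₀ * S₂ - S₁ ^ 2) := by linarith
  linarith [nonneg_of_mul_nonneg_right this hS₀]

/-- Turán-type inequality:
`E_{α,β}^γ(t^α)[E_{α,α+β}^{γ+1}(t^α) + t^α E_{α,2α+β}^{γ+2}(t^α)] ≥ γ t^α Δ_T(t)`. -/
theorem prabhakar_turan_inequality (α β γ t : ℝ) (hα : 0 < α) (hβ : 0 < β) (hγ : 0 < γ)
    (ht : 0 < t) :
    prabhakar α β γ (t ^ α)
        * (prabhakar α (α + β) (γ + 1) (t ^ α) + t ^ α * prabhakar α (2 * α + β) (γ + 2) (t ^ α))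
      ≥ γ * t ^ α * ((prabhakar α (α + β) (γ + 1) (t ^ α)) ^ 2
          - prabhakar α β γ (t ^ α) * prabhakar α (2 * α + β) (γ + 2) (t ^ α)) := by
  have hx : 0 < t ^ α := Real.rpow_pos_of_pos ht α
  set x := t ^ α
  have hpos := prabhakarTerm_pos hα hβ hγ hx
  have h₀ := hasSum_prabhakarTerm hα hβ hγ hx
  have hS₀ : 0 < prabhakar α β γ x :=
    (hpos 0).trans_le (le_hasSum h₀ 0 fun k _ => (hpos k).le)
  have key := sq_le_mul_of_hasSum_moments (fun k => (hpos k).le) hS₀ h₀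
    (hasSum_natCast_mul_prabhakarTerm hα hβ hγ hx)
    (hasSum_natCast_sq_mul_prabhakarTerm hα hβ hγ hx)
  refine le_of_mul_le_mul_left ?_ (mul_pos hγ hx)
  linarith
end
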